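/- arXiv:0803.2262 — 5 statements merged into one kernel-verified Lean document; each statement's English description precedes it below -/
import Mathlib

section
/- (Bassalygo–Elias bound for rank metric codes) Let q be a prime power, 1 ≤ r, d ≤ n ≤ m, let k, l satisfy max{r,d} ≤ k ≤ n and k ≤ l ≤ m, let 0 ≤ s ≤ k, and let 𝒟 be any nonempty set of l×k matrices over GF(q) in which any two distinct elements have rank distance ≥ d. Then N_R(q,l,k,s) · A_R(q,m,n,d,r) ≥ |{(X, c) : X ∈ GF(q)^{l×k}, rank(X) = s, c ∈ 𝒟, rank(X − c) = r}|. -/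
open Module

noncomputable def injDist {F V : Type*} [Field F] [AddCommGroup V] [Module F V]
    (U W : Submodule F V) : ℕ :=
  finrank F ↥(U ⊔ W) - min (finrank F ↥U) (finrank F ↥W)

def rowSpace {F : Type*} [CommRing F] {m n : ℕ} (X : Matrix (Fin m) (Fin n) F) :
    Submodule F (Fin n → F) :=
  LinearMap.range X.vecMulLinear

def colSpace {F : Type*} [CommRing F] {m n : ℕ} (X : Matrix (Fin m) (Fin n) F) :
    Submodule F (Fin m → F) :=
  LinearMap.range X.mulVecLin

noncomputable def minRankDist {F : Type*} [Field F] {m n : ℕ}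
    (C : Set (Matrix (Fin m) (Fin n) F)) : ℕ :=
  sInf {e | ∃ X ∈ C, ∃ Y ∈ C, X ≠ Y ∧ (X - Y).rank = e}

noncomputable def minInjDist {F V : Type*} [Field F] [AddCommGroup V] [Module F V]
    (S : Set (Submodule F V)) : ℕ :=
  sInf {e | ∃ U ∈ S, ∃ W ∈ S, U ≠ W ∧ injDist U W = e}

/-- Maximum cardinality of a nonempty code of `m × n` matrices whose ranks all lie in `I`
and in which any two distinct codewords are at rank distance at least `d`. -/
noncomputable def maxRankCode (F : Type*) [Field F] [Fintype F] (m n d : ℕ) (I : Set ℕ) : ℕ :=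
  sSup {c : ℕ | ∃ C : Set (Matrix (Fin m) (Fin n) F), C.Nonempty ∧
    (∀ X ∈ C, X.rank ∈ I) ∧
    (∀ X ∈ C, ∀ Y ∈ C, X ≠ Y → d ≤ (X - Y).rank) ∧ C.ncard = c}

/-- `A_R(q,m,n,d,r)` : maximum cardinality of a constant-rank code of constant rank `r`
and minimum rank distance at least `d` in `GF(q)^{m × n}`. -/
noncomputable def A_R (F : Type*) [Field F] [Fintype F] (m n d r : ℕ) : ℕ :=
  maxRankCode F m n d {r}

/-- `A_C(q,n,r,d)` : maximum cardinality of a constant-dimension code of dimension `r`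
and minimum injection distance at least `d` in `GF(q)^n`. -/
noncomputable def A_C (F : Type*) [Field F] [Fintype F] (n r d : ℕ) : ℕ :=
  sSup {c : ℕ | ∃ S : Set (Submodule F (Fin n → F)), S.Nonempty ∧
    (∀ U ∈ S, finrank F ↥U = r) ∧
    (∀ U ∈ S, ∀ V ∈ S, U ≠ V → d ≤ injDist U V) ∧ S.ncard = c}

/-- `N_R(q,m,n,r)` : number of `m × n` matrices over `GF(q)` of rank `r`. -/
noncomputable def N_R (F : Type*) [Field F] [Fintype F] (m n r : ℕ) : ℕ :=
  Nat.card {X : Matrix (Fin m) (Fin n) F // X.rank = r}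

/-- `α(m,s) = ∏_{i=0}^{s-1} (q^m - q^i)`. -/
def alphaq (q m s : ℕ) : ℕ := ∏ i ∈ Finset.range s, (q ^ m - q ^ i)

/-- The Gaussian binomial `[n r]_q = α(n,r) / α(r,r)`. -/
def gaussBinom (q n r : ℕ) : ℕ := alphaq q n r / alphaq q r r

/-- `K_q = ∏_{j=1}^∞ (1 - q^{-j})`. -/
noncomputable def Kq (q : ℕ) : ℝ := ∏' j : ℕ, (1 - ((q : ℝ))⁻¹ ^ (j + 1))

/-- `M(q,m,n,d,r)` : the number of codewords of rank `r` in an `(n, n-d+1, d)` linear MRD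
code over `GF(q^m)`. -/
def Mcount (q m n d r : ℕ) : ℤ :=
  (gaussBinom q n r : ℤ) *
    ∑ j ∈ Finset.Icc d r, (-1 : ℤ) ^ (r - j) * (gaussBinom q r j : ℤ) *
      (q : ℤ) ^ ((r - j) * (r - j - 1) / 2) * ((q : ℤ) ^ (m * (j - d + 1)) - 1)

theorem rank_embed {F : Type*} [Field F] {l k m n : ℕ} (hlm : l ≤ m) (hkn : k ≤ n) :
    ∃ (P : Matrix (Fin m) (Fin l) F) (Q : Matrix (Fin k) (Fin n) F),
      ∀ A : Matrix (Fin l) (Fin k) F, (P * A * Q).rank = A.rank := by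
  let P : Matrix (Fin m) (Fin l) F :=
    (1 : Matrix (Fin m) (Fin m) F).submatrix id (Fin.castLE hlm)
  let P' : Matrix (Fin l) (Fin m) F :=
    (1 : Matrix (Fin m) (Fin m) F).submatrix (Fin.castLE hlm) id
  let Q : Matrix (Fin k) (Fin n) F :=
    (1 : Matrix (Fin n) (Fin n) F).submatrix (Fin.castLE hkn) id
  let Q' : Matrix (Fin n) (Fin k) F :=
    (1 : Matrix (Fin n) (Fin n) F).submatrix id (Fin.castLE hkn)
  have hP : P' * P = 1 := by
    simp only [P, P']
    rw [← Matrix.submatrix_mul _ _ _ _ _ Function.bijective_id, Matrix.mul_one,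
      Matrix.submatrix_one _ (Fin.castLE_injective hlm)]
  have hQ : Q * Q' = 1 := by
    simp only [Q, Q']
    rw [← Matrix.submatrix_mul _ _ _ _ _ Function.bijective_id, Matrix.mul_one,
      Matrix.submatrix_one _ (Fin.castLE_injective hkn)]
  refine ⟨P, Q, fun A => le_antisymm ?_ ?_⟩
  · exact (Matrix.rank_mul_le_left _ _).trans (Matrix.rank_mul_le_right _ _)
  · have h : A = P' * (P * A * Q) * Q' := by
      calc A = (P' * P) * A * (Q * Q') := by rw [hP, hQ, Matrix.one_mul, Matrix.mul_one]
        _ = _ := by simp only [Matrix.mul_assoc]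
    conv_lhs => rw [h]
    exact (Matrix.rank_mul_le_left _ _).trans (Matrix.rank_mul_le_right _ _)

theorem le_A_R {F : Type*} [Field F] [Fintype F] {m n d r : ℕ}
    (C : Set (Matrix (Fin m) (Fin n) F)) (h1 : ∀ X ∈ C, X.rank = r)
    (h2 : ∀ X ∈ C, ∀ Y ∈ C, X ≠ Y → d ≤ (X - Y).rank) :
    C.ncard ≤ A_R F m n d r := by
  rcases C.eq_empty_or_nonempty with rfl | hne
  · simp
  · refine le_csSup ⟨Nat.card (Matrix (Fin m) (Fin n) F), ?_⟩ ⟨C, hne, h1, h2, rfl⟩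
    rintro c ⟨C', -, -, -, rfl⟩
    exact Set.ncard_le_card C'

theorem stmt12 {q m n d r k l s : ℕ} (F : Type*) [Field F] [Fintype F]
    (hF : Fintype.card F = q)
    (hr1 : 1 ≤ r) (hd1 : 1 ≤ d) (hrn : r ≤ n) (hdn : d ≤ n) (hnm : n ≤ m)
    (hk : max r d ≤ k) (hkn : k ≤ n) (hkl : k ≤ l) (hlm : l ≤ m) (hsk : s ≤ k)
    (D : Set (Matrix (Fin l) (Fin k) F)) (hDne : D.Nonempty)
    (hDdist : ∀ X ∈ D, ∀ Y ∈ D, X ≠ Y → d ≤ (X - Y).rank) :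
    Nat.card {p : Matrix (Fin l) (Fin k) F × Matrix (Fin l) (Fin k) F //
        p.1.rank = s ∧ p.2 ∈ D ∧ (p.1 - p.2).rank = r}
      ≤ N_R F l k s * A_R F m n d r := by
  classical
  obtain ⟨P, Q, hPQ⟩ := rank_embed (F := F) hlm hkn
  let e : {p : Matrix (Fin l) (Fin k) F × Matrix (Fin l) (Fin k) F //
        p.1.rank = s ∧ p.2 ∈ D ∧ (p.1 - p.2).rank = r} ≃
      Σ X : {X : Matrix (Fin l) (Fin k) F // X.rank = s},
        ({c | c ∈ D ∧ (X.1 - c).rank = r} : Set (Matrix (Fin l) (Fin k) F)) :=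
    { toFun := fun p => ⟨⟨p.1.1, p.2.1⟩, ⟨p.1.2, p.2.2⟩⟩
      invFun := fun y => ⟨(y.1.1, y.2.1), y.1.2, y.2.2⟩
      left_inv := fun _ => rfl
      right_inv := fun _ => rfl }
  rw [Nat.card_congr e, Nat.card_sigma, N_R, Nat.card_eq_fintype_card, ← Finset.card_univ,
    ← smul_eq_mul]
  refine Finset.sum_le_card_nsmul _ _ _ fun X _ => ?_
  rw [Nat.card_coe_set_eq]
  set S : Set (Matrix (Fin l) (Fin k) F) := {c | c ∈ D ∧ (X.1 - c).rank = r}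
  let f : Matrix (Fin l) (Fin k) F → Matrix (Fin m) (Fin n) F := fun c => P * (X.1 - c) * Q
  have hf : ∀ a b, (f a - f b).rank = (b - a).rank := by
    intro a b
    rw [← hPQ (b - a)]
    congr 1
    simp only [f, ← Matrix.sub_mul, ← Matrix.mul_sub]
    congr 2
    abel
  have hinj : Set.InjOn f S := by
    intro a ha b hb hab
    by_contra hne
    have h := hDdist b hb.1 a ha.1 (Ne.symm hne)
    rw [← hf, hab, sub_self, Matrix.rank_zero] at h
    omega
  rw [← Set.ncard_image_of_injOn hinj]
  apply le_A_R
  · rintro _ ⟨c, hc, rfl⟩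
    exact (hPQ _).trans hc.2
  · rintro _ ⟨a, ha, rfl⟩ _ ⟨b, hb, rfl⟩ hne
    rw [hf]
    exact hDdist b hb.1 a ha.1 (fun h => hne (by rw [h]))
end

section
/- (Extended Bassalygo–Elias bound) Let q be a prime power, 1 ≤ r ≤ n ≤ m, r+1 < d ≤ 2r, let k, l satisfy max{r,d} ≤ k ≤ n and k ≤ l ≤ m, let 0 ≤ s ≤ k, and let 𝒟 be any nonempty set of l×k matrices over GF(q) in which any two distinct elements have rank distance ≥ d. Then |{(X, c) : X ∈ GF(q)^{l×k}, rank(X) = s, c ∈ 𝒟, rank(X − c) = r}| ≤ (N_R(q,l,k,s) − |{(X, c) : X ∈ GF(q)^{l×k}, rank(X) = s, c ∈ 𝒟, rank(X − c) ≤ d−r−1}|) · A_R(q,m,n,d,r). -/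
open Module

theorem rank_add_le_aux {F : Type*} [Field F] {l k : ℕ} (A B : Matrix (Fin l) (Fin k) F) :
    (A + B).rank ≤ A.rank + B.rank := by
  unfold Matrix.rank
  rw [Matrix.mulVecLin_add]
  have h : LinearMap.range (A.mulVecLin + B.mulVecLin) ≤
      LinearMap.range A.mulVecLin ⊔ LinearMap.range B.mulVecLin := by
    rintro _ ⟨v, rfl⟩
    exact Submodule.add_mem_sup (LinearMap.mem_range_self _ v) (LinearMap.mem_range_self _ v)
  exact (Submodule.finrank_mono h).trans (Submodule.finrank_add_le_finrank_add_finrank _ _)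

theorem rank_dist_tri {F : Type*} [Field F] {l k : ℕ} (X c e : Matrix (Fin l) (Fin k) F) :
    (c - e).rank ≤ (X - c).rank + (X - e).rank := by
  have h : c - e = (X - e) + (-(X - c)) := by abel
  have h2 : (-(X - c)).rank ≤ (X - c).rank := by
    have h3 : -(X - c) = (X - c) * (-1 : Matrix (Fin k) (Fin k) F) := by
      rw [Matrix.mul_neg, Matrix.mul_one]
    rw [h3]
    exact Matrix.rank_mul_le_left _ _
  rw [h]
  have := rank_add_le_aux (X - e) (-(X - c))
  omega

/-- Zero-padding of matrices. -/
def padMat {F : Type*} [Field F] {l k m n : ℕ} (hl : l ≤ m) (hk : k ≤ n)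
    (X : Matrix (Fin l) (Fin k) F) : Matrix (Fin m) (Fin n) F :=
  (1 : Matrix (Fin m) (Fin m) F).submatrix id (Fin.castLE hl) * X *
    (1 : Matrix (Fin n) (Fin n) F).submatrix (Fin.castLE hk) id

theorem padMat_sub {F : Type*} [Field F] {l k m n : ℕ} (hl : l ≤ m) (hk : k ≤ n)
    (X Y : Matrix (Fin l) (Fin k) F) :
    padMat hl hk X - padMat hl hk Y = padMat hl hk (X - Y) := by
  simp only [padMat, Matrix.mul_sub, Matrix.sub_mul]

theorem padMat_left {F : Type*} [Field F] {l m : ℕ} (hl : l ≤ m) :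
    (1 : Matrix (Fin m) (Fin m) F).submatrix (Fin.castLE hl) id *
    (1 : Matrix (Fin m) (Fin m) F).submatrix id (Fin.castLE hl) = 1 := by
  rw [← Matrix.submatrix_mul _ _ _ _ _ Function.bijective_id, Matrix.mul_one]
  exact Matrix.submatrix_one _ (Fin.castLE_injective hl)

theorem padMat_inv {F : Type*} [Field F] {l k m n : ℕ} (hl : l ≤ m) (hk : k ≤ n)
    (X : Matrix (Fin l) (Fin k) F) :
    (1 : Matrix (Fin m) (Fin m) F).submatrix (Fin.castLE hl) id * padMat hl hk X *
      (1 : Matrix (Fin n) (Fin n) F).submatrix id (Fin.castLE hk) = X := by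
  unfold padMat
  rw [Matrix.mul_assoc _ X _, ← Matrix.mul_assoc, padMat_left, Matrix.one_mul,
    Matrix.mul_assoc, padMat_left, Matrix.mul_one]

theorem padMat_rank {F : Type*} [Field F] {l k m n : ℕ} (hl : l ≤ m) (hk : k ≤ n)
    (X : Matrix (Fin l) (Fin k) F) : (padMat hl hk X).rank = X.rank := by
  apply le_antisymm
  · exact (Matrix.rank_mul_le_left _ _).trans (Matrix.rank_mul_le_right _ _)
  · conv_lhs => rw [← padMat_inv hl hk X]
    exact (Matrix.rank_mul_le_left _ _).trans (Matrix.rank_mul_le_right _ _)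

theorem padMat_inj {F : Type*} [Field F] {l k m n : ℕ} (hl : l ≤ m) (hk : k ≤ n) :
    Function.Injective (padMat (F := F) hl hk) := by
  intro X Y h
  rw [← padMat_inv hl hk X, h, padMat_inv]

theorem ncard_le_A_R {F : Type*} [Field F] [Fintype F] {m n d r : ℕ}
    (C : Set (Matrix (Fin m) (Fin n) F)) (hr : ∀ X ∈ C, X.rank = r)
    (hd : ∀ X ∈ C, ∀ Y ∈ C, X ≠ Y → d ≤ (X - Y).rank) : C.ncard ≤ A_R F m n d r := by
  rcases C.eq_empty_or_nonempty with h | h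
  · simp [h]
  · apply le_csSup
    · refine ⟨Nat.card (Matrix (Fin m) (Fin n) F), ?_⟩
      rintro c ⟨C', -, -, -, rfl⟩
      exact Set.ncard_le_card C'
    · exact ⟨C, h, hr, hd, rfl⟩

theorem stmt13 {q m n d r k l s : ℕ} (F : Type*) [Field F] [Fintype F]
    (hF : Fintype.card F = q)
    (hr1 : 1 ≤ r) (hrn : r ≤ n) (hnm : n ≤ m) (hrd : r + 1 < d) (hd2r : d ≤ 2 * r)
    (hk : max r d ≤ k) (hkn : k ≤ n) (hkl : k ≤ l) (hlm : l ≤ m) (hsk : s ≤ k)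
    (D : Set (Matrix (Fin l) (Fin k) F)) (hDne : D.Nonempty)
    (hDdist : ∀ X ∈ D, ∀ Y ∈ D, X ≠ Y → d ≤ (X - Y).rank) :
    Nat.card {p : Matrix (Fin l) (Fin k) F × Matrix (Fin l) (Fin k) F //
        p.1.rank = s ∧ p.2 ∈ D ∧ (p.1 - p.2).rank = r}
      ≤ (N_R F l k s -
          Nat.card {p : Matrix (Fin l) (Fin k) F × Matrix (Fin l) (Fin k) F //
            p.1.rank = s ∧ p.2 ∈ D ∧ (p.1 - p.2).rank ≤ d - r - 1}) * A_R F m n d r := by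
  classical
  have hFin : Fintype (Matrix (Fin l) (Fin k) F) := Fintype.ofFinite _
  let M := Matrix (Fin l) (Fin k) F
  let PA : Finset (M × M) :=
    Finset.univ.filter fun p => p.1.rank = s ∧ p.2 ∈ D ∧ (p.1 - p.2).rank = r
  let PB : Finset (M × M) :=
    Finset.univ.filter fun p => p.1.rank = s ∧ p.2 ∈ D ∧ (p.1 - p.2).rank ≤ d - r - 1
  let S : Finset M := Finset.univ.filter fun X => X.rank = s
  have hA : Nat.card {p : M × M // p.1.rank = s ∧ p.2 ∈ D ∧ (p.1 - p.2).rank = r} = PA.card := by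
    rw [Nat.card_eq_fintype_card, Fintype.card_subtype]
  have hB : Nat.card {p : M × M // p.1.rank = s ∧ p.2 ∈ D ∧ (p.1 - p.2).rank ≤ d - r - 1}
      = PB.card := by
    rw [Nat.card_eq_fintype_card, Fintype.card_subtype]
  have hS : N_R F l k s = S.card := by
    unfold N_R
    rw [Nat.card_eq_fintype_card, Fintype.card_subtype]
  rw [hA, hB, hS]
  have key : ∀ X c e : M, c ∈ D → e ∈ D → (X - c).rank ≤ d - r - 1 → (X - e).rank ≤ r → c = e := by
    intro X c e hc he h1 h2
    by_contra hne
    have h3 := hDdist c hc e he hne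
    have h4 := rank_dist_tri X c e
    omega
  have hinj : Set.InjOn Prod.fst (PB : Set (M × M)) := by
    rintro ⟨X, c⟩ hp ⟨Y, e⟩ hp' hXY
    simp only [PB, Finset.coe_filter, Finset.mem_univ, true_and, Set.mem_ofPred_eq] at hp hp'
    obtain rfl : X = Y := hXY
    rw [key X c e hp.2.1 hp'.2.1 hp.2.2 (by omega)]
  have hsub : PB.image Prod.fst ⊆ S := by
    intro X hX
    obtain ⟨p, hp, rfl⟩ := Finset.mem_image.1 hX
    exact Finset.mem_filter.2 ⟨Finset.mem_univ _, (Finset.mem_filter.1 hp).2.1⟩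
  have hT : (S \ PB.image Prod.fst).card = S.card - PB.card := by
    rw [Finset.card_sdiff_of_subset hsub, Finset.card_image_of_injOn hinj]
  rw [← hT, mul_comm]
  apply Finset.card_le_mul_card_image_of_maps_to (f := Prod.fst)
  · rintro ⟨X, c⟩ hp
    obtain ⟨-, h1, h2, h3⟩ := Finset.mem_filter.1 hp
    refine Finset.mem_sdiff.2 ⟨Finset.mem_filter.2 ⟨Finset.mem_univ _, h1⟩, fun hX => ?_⟩
    obtain ⟨⟨Y, e⟩, hp', hYX⟩ := Finset.mem_image.1 hX
    obtain ⟨-, h1', h2', h3'⟩ := Finset.mem_filter.1 hp'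
    dsimp only at hYX h1 h2 h3 h1' h2' h3'
    subst hYX
    have := key Y e c h2' h2 h3' h3.le
    subst this
    omega
  · intro X _
    let g : M × M → Matrix (Fin m) (Fin n) F := fun p => padMat hlm hkn (p.1 - p.2)
    have hg : Set.InjOn g ((PA.filter fun a => a.1 = X : Finset (M × M)) : Set (M × M)) := by
      rintro ⟨Y, c⟩ hp ⟨Z, e⟩ hp' h
      have h1 : Y = X := (Finset.mem_filter.1 hp).2
      have h2 : Z = X := (Finset.mem_filter.1 hp').2
      subst h1 h2
      have h3 : Z - c = Z - e := padMat_inj hlm hkn h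
      rw [sub_right_inj.1 h3]
    rw [← Finset.card_image_of_injOn hg, ← Set.ncard_coe_finset]
    apply ncard_le_A_R
    · intro Z hZ
      obtain ⟨p, hp, rfl⟩ := Finset.mem_image.1 (Finset.mem_coe.1 hZ)
      simp only [g, padMat_rank]
      exact (Finset.mem_filter.1 (Finset.mem_filter.1 hp).1).2.2.2
    · intro Z hZ W hW hne
      obtain ⟨⟨Y, c⟩, hp, rfl⟩ := Finset.mem_image.1 (Finset.mem_coe.1 hZ)
      obtain ⟨⟨Y', e⟩, hp', rfl⟩ := Finset.mem_image.1 (Finset.mem_coe.1 hW)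
      have h1 : Y = X := (Finset.mem_filter.1 hp).2
      have h2 : Y' = X := (Finset.mem_filter.1 hp').2
      subst h1 h2
      have hc := (Finset.mem_filter.1 (Finset.mem_filter.1 hp).1).2.2.1
      have he := (Finset.mem_filter.1 (Finset.mem_filter.1 hp').1).2.2.1
      simp only [g, padMat_sub, padMat_rank, sub_sub_sub_cancel_left]
      refine hDdist e he c hc ?_
      rintro rfl
      exact hne rfl
end

section
/- Let q be a prime power and 1 ≤ r, d ≤ n ≤ m. Then A_R(q,m,n,d,r) · q^{m(d−1)} ≥ N_R(q,m,n,r). -/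
open Module

open Polynomial in
/-- Moore-matrix nonsingularity (polynomial side). -/
lemma moore_left {F K : Type*} [Field F] [Fintype F] [Field K] [Algebra F K]
    {s : ℕ} (g : Fin s → K) (hg : LinearIndependent F g) (a : Fin s → K)
    (ha : ∀ t, ∑ i : Fin s, a i * g t ^ (Fintype.card F ^ (i : ℕ)) = 0) : a = 0 := by
  classical
  have hq : 1 < Fintype.card F := Fintype.one_lt_card
  let σ := FiniteField.frobeniusAlgHom F K
  have hσ : ∀ (i : ℕ) (y : K), (σ ^ i) y = y ^ (Fintype.card F ^ i) := by
    intro i y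
    simp only [σ, AlgHom.coe_pow, FiniteField.coe_frobeniusAlgHom, pow_iterate]
  let P : K[X] := ∑ i : Fin s, C (a i) * X ^ (Fintype.card F ^ (i : ℕ))
  have hinj : Function.Injective (fun c : Fin s → F => ∑ t, c t • g t) := by
    intro c c' h
    have := Fintype.linearIndependent_iff.1 hg (c - c') (by
      simpa [sub_smul, Finset.sum_sub_distrib, sub_eq_zero] using h)
    funext t
    exact sub_eq_zero.1 (this t)
  have hP : P = 0 := by
    rcases Nat.eq_zero_or_pos s with h0 | h0
    · subst h0
      simp [P]
    refine Polynomial.eq_zero_of_natDegree_lt_card_of_eval_eq_zero P hinj ?_ ?_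
    · intro c
      have h1 : ∀ i : Fin s, (∑ t, c t • g t) ^ (Fintype.card F ^ (i : ℕ))
          = ∑ t, c t • g t ^ (Fintype.card F ^ (i : ℕ)) := by
        intro i
        rw [← hσ, map_sum]
        refine Finset.sum_congr rfl fun k _ => ?_
        rw [map_smul, hσ]
      simp only [P, eval_finsetSum, eval_mul, eval_C, eval_pow, eval_X, h1]
      simp only [Finset.mul_sum]
      rw [Finset.sum_comm]
      refine Finset.sum_eq_zero fun t _ => ?_
      simp only [mul_smul_comm]
      rw [← Finset.smul_sum, ha t, smul_zero]
    · simp only [Fintype.card_pi, Finset.prod_const, Finset.card_univ, Fintype.card_fin]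
      refine lt_of_le_of_lt (b := Fintype.card F ^ (s - 1)) ?_ (Nat.pow_lt_pow_right hq (by omega))
      refine natDegree_sum_le_of_forall_le _ _ fun i _ => ?_
      refine (natDegree_C_mul_X_pow_le _ _).trans (Nat.pow_le_pow_right (by omega) (by omega))
  funext i
  have h2 : P.coeff (Fintype.card F ^ (i : ℕ)) = a i := by
    simp only [P, finsetSum_coeff, coeff_C_mul, coeff_X_pow]
    rw [Finset.sum_eq_single i]
    · simp
    · intro j _ hj
      rw [if_neg, mul_zero]
      intro h
      exact hj (Fin.ext (Nat.pow_right_injective hq h.symm))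
    · simp
  rw [← h2, hP]
  simp

/-- Moore-matrix nonsingularity (transposed side). -/
lemma moore_right {F K : Type*} [Field F] [Fintype F] [Field K] [Algebra F K]
    {s : ℕ} (g : Fin s → K) (hg : LinearIndependent F g) (c : Fin s → K)
    (hc : ∀ i : Fin s, ∑ t, c t * g t ^ (Fintype.card F ^ (i : ℕ)) = 0) : c = 0 := by
  classical
  let M : Matrix (Fin s) (Fin s) K := fun t i => g t ^ (Fintype.card F ^ (i : ℕ))
  have hdet : M.det ≠ 0 := by
    intro h
    obtain ⟨v, hv, hv0⟩ := Matrix.exists_mulVec_eq_zero_iff.2 h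
    apply hv
    apply moore_left g hg v
    intro t
    have := congrFun hv0 t
    simpa [Matrix.mulVec, dotProduct, M, mul_comm] using this
  by_contra hne
  apply hdet
  refine Matrix.exists_vecMul_eq_zero_iff.1 ⟨c, hne, ?_⟩
  funext i
  simpa [Matrix.vecMul, dotProduct, M] using hc i

lemma exists_ext (F : Type*) [Field F] [Fintype F] (m : ℕ) (hm : 0 < m) :
    ∃ (K : Type) (_ : Field K) (_ : Algebra F K) (_ : Fintype K),
      Nonempty ((Fin m → F) ≃ₗ[F] K) := by
  obtain ⟨p, hp⟩ := CharP.exists F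
  have : Fact p.Prime := ⟨CharP.char_is_prime F p⟩
  have : NeZero m := ⟨hm.ne'⟩
  refine ⟨FiniteField.Extension F p m, inferInstance, inferInstance, Fintype.ofFinite _, ?_⟩
  refine ⟨LinearEquiv.ofFinrankEq _ _ ?_⟩
  rw [FiniteField.finrank_extension]
  simp

/-- The Gabidulin syndrome of a nonzero matrix of rank `< d` does not vanish. -/
lemma gab {F K : Type*} [Field F] [Fintype F] [Field K] [Algebra F K] {m n d : ℕ}
    (e : (Fin m → F) ≃ₗ[F] K) (h : Fin n → K) (hh : LinearIndependent F h)
    (X : Matrix (Fin m) (Fin n) F) (hX : X.rank ≤ d)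
    (h0 : ∀ i : Fin d, ∑ j, e (X.col j) * h j ^ (Fintype.card F ^ (i : ℕ)) = 0) : X = 0 := by
  classical
  rw [Matrix.rank_eq_finrank_span_cols] at hX
  let V := Submodule.span F (Set.range X.col)
  let s := finrank F V
  let b : Basis (Fin s) F V := finBasis F V
  let x : Fin n → V := fun j => ⟨X.col j, Submodule.subset_span ⟨j, rfl⟩⟩
  let A : Fin s → Fin n → F := fun t j => b.repr (x j) t
  have hx : ∀ j, e (X.col j) = ∑ t, A t j • e (b t : Fin m → F) := by
    intro j
    have h1 : (∑ t, A t j • b t) = x j := b.sum_repr (x j)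
    have h2 := congrArg (fun v : V => e (v : Fin m → F)) h1
    simp only [Submodule.coe_sum, Submodule.coe_smul, map_sum, map_smul] at h2
    exact h2.symm
  let g : Fin s → K := fun t => ∑ j, A t j • h j
  have hg : LinearIndependent F g := by
    rw [Fintype.linearIndependent_iff]
    intro l hl
    have h1 : ∑ j, (∑ t, l t * A t j) • h j = 0 := by
      rw [← hl]
      simp only [g, Finset.smul_sum, Finset.sum_smul, mul_smul]
      rw [Finset.sum_comm]
    have h2 := Fintype.linearIndependent_iff.1 hh _ h1
    let f : V →ₗ[F] F := b.constr F l
    have hf : ∀ v : V, f v = 0 := by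
      rintro ⟨v, hv⟩
      induction hv using Submodule.span_induction with
      | mem y hy =>
        obtain ⟨j, rfl⟩ := hy
        have := h2 j
        simp only [f, Basis.constr_apply_fintype]
        simpa [A, x, mul_comm] using this
      | zero => exact map_zero f
      | add y z hy hz h3 h4 =>
        have := map_add f ⟨y, hy⟩ ⟨z, hz⟩
        rw [h3, h4, add_zero] at this
        exact this
      | smul a y hy h3 =>
        have := map_smul f a ⟨y, hy⟩
        rw [h3, smul_zero] at this
        exact this
    intro t
    have := hf (b t)
    simpa [f] using this
  have hc : (fun t => e (b t : Fin m → F)) = 0 := by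
    apply moore_right g hg
    intro i
    have h1 := h0 ⟨i, lt_of_lt_of_le i.2 hX⟩
    rw [← h1]
    have h2 : ∀ t, g t ^ (Fintype.card F ^ (i : ℕ))
        = ∑ j, A t j • h j ^ (Fintype.card F ^ (i : ℕ)) := by
      intro t
      have hσ : ∀ (y : K), (FiniteField.frobeniusAlgHom F K ^ (i : ℕ)) y
          = y ^ (Fintype.card F ^ (i : ℕ)) := by
        intro y
        simp only [AlgHom.coe_pow, FiniteField.coe_frobeniusAlgHom, pow_iterate]
      rw [← hσ, map_sum]
      refine Finset.sum_congr rfl fun k _ => ?_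
      rw [map_smul, hσ]
    simp only [h2, hx, Finset.mul_sum, Finset.sum_mul]
    rw [Finset.sum_comm]
    simp only [mul_smul_comm, smul_mul_assoc]
  ext i j
  have h3 : e (X.col j) = 0 := by
    rw [hx]
    refine Finset.sum_eq_zero fun t _ => ?_
    have := congrFun hc t
    simp only [Pi.zero_apply] at this
    rw [this, smul_zero]
  have h4 : X.col j = 0 := by simpa using h3
  exact congrFun h4 i

theorem stmt14 {q m n d r : ℕ} (F : Type*) [Field F] [Fintype F] (hF : Fintype.card F = q)
    (hr1 : 1 ≤ r) (hd1 : 1 ≤ d) (hrn : r ≤ n) (hdn : d ≤ n) (hnm : n ≤ m) :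
    N_R F m n r ≤ A_R F m n d r * q ^ (m * (d - 1)) := by
  classical
  obtain ⟨K, _, _, _, ⟨e⟩⟩ := exists_ext F m (by omega)
  let h : Fin n → K := fun j => e (Pi.single (Fin.castLE hnm j) 1)
  have hh : LinearIndependent F h := by
    have h1 := (Pi.basisFun F (Fin m)).linearIndependent.comp _ (Fin.castLE_injective hnm)
    have h2 := h1.map' e.toLinearMap e.ker
    have h3 : h = e.toLinearMap ∘ Pi.basisFun F (Fin m) ∘ Fin.castLE hnm := by
      funext j
      simp [h]
    rw [h3]
    exact h2
  let φ : Matrix (Fin m) (Fin n) F → (Fin (d - 1) → K) :=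
    fun X i => ∑ j, e (X.col j) * h j ^ (Fintype.card F ^ (i : ℕ))
  have hφ : ∀ X Y, φ X = φ Y → X ≠ Y → d ≤ (X - Y).rank := by
    intro X Y hXY hne
    by_contra hlt
    apply hne
    rw [← sub_eq_zero]
    refine gab (d := d - 1) e h hh (X - Y) (by omega) ?_
    intro i
    have h1 := congrFun hXY i
    have h2 : ∀ j, (X - Y).col j = X.col j - Y.col j := fun j => rfl
    simp only [h2, map_sub, sub_mul, Finset.sum_sub_distrib]
    exact sub_eq_zero.2 h1
  let S : Finset (Matrix (Fin m) (Fin n) F) := Finset.univ.filter (fun X => X.rank = r)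
  have hN : N_R F m n r = S.card := by
    rw [N_R, Nat.card_eq_fintype_card, Fintype.card_subtype]
  have hK : Fintype.card (Fin (d - 1) → K) = q ^ (m * (d - 1)) := by
    rw [Fintype.card_pi, Finset.prod_const, Finset.card_univ, Fintype.card_fin,
      ← Fintype.card_congr e.toEquiv, Fintype.card_pi, Finset.prod_const, Finset.card_univ,
      Fintype.card_fin, hF, ← pow_mul]
  rw [hN, ← hK]
  refine Finset.card_le_mul_card_image_of_maps_to (f := φ) (t := Finset.univ)
    (fun _ _ => Finset.mem_univ _) _ ?_
  intro y _
  rcases (S.filter (fun X => φ X = y)).eq_empty_or_nonempty with h0 | h0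
  · rw [h0]; simp
  refine le_csSup ⟨Nat.card (Matrix (Fin m) (Fin n) F), ?_⟩ ?_
  · rintro c ⟨C, -, -, -, rfl⟩
    exact Set.ncard_le_card C
  · refine ⟨↑(S.filter (fun X => φ X = y)), Finset.coe_nonempty.2 h0, ?_, ?_, Set.ncard_coe_finset _⟩
    · intro X hX
      simp only [Finset.coe_filter, Set.mem_ofPred_eq, S, Finset.mem_filter] at hX
      exact hX.1.2
    · intro X hX Y hY hne
      simp only [Finset.coe_filter, Set.mem_ofPred_eq] at hX hY
      exact hφ X Y (hX.2.trans hY.2.symm) hne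
end

section
/- Let q be a prime power and 1 ≤ r ≤ n ≤ m. Then A_R(q,m,n,r,r) = [n r]_q · (q^m − 1). -/
open Module

theorem card_subspaces_mul (F : Type*) [Field F] [Fintype F] {V : Type*} [AddCommGroup V]
    [Module F V] [Module.Finite F V] (k : ℕ) (hk : k ≤ finrank F V) :
    Nat.card {W : Submodule F V // finrank F W = k} * alphaq (Fintype.card F) k k =
      alphaq (Fintype.card F) (finrank F V) k := by
  classical
  have : Finite V := Module.finite_of_finite F
  have : Finite (Submodule F V) := Finite.of_injective (fun W => (W : Set V)) SetLike.coe_injective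
  have hfin := Fintype.ofFinite {W : Submodule F V // finrank F W = k}
  let f : (Σ W : {W : Submodule F V // finrank F W = k},
      {s : Fin k → W.1 // LinearIndependent F s}) → {s : Fin k → V // LinearIndependent F s} :=
    fun x => ⟨fun i => (x.2.1 i : V), x.2.2.map' x.1.1.subtype (Submodule.ker_subtype _)⟩
  have key : ∀ x, Submodule.span F (Set.range (f x).1) = x.1.1 := by
    intro x
    apply Submodule.eq_of_le_of_finrank_eq
    · rw [Submodule.span_le]
      rintro _ ⟨i, rfl⟩
      exact (x.2.1 i).2
    · rw [finrank_span_eq_card (f x).2, x.1.2, Fintype.card_fin]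
  have hf : Function.Bijective f := by
    constructor
    · intro x y hxy
      have h1 : x.1 = y.1 := Subtype.ext (by rw [← key x, ← key y, hxy])
      obtain ⟨W, s⟩ := x
      obtain ⟨W', t⟩ := y
      obtain rfl : W = W' := h1
      congr 1
      apply Subtype.ext
      funext i
      apply Subtype.ext
      exact congrFun (congrArg Subtype.val hxy) i
    · rintro ⟨s, hs⟩
      refine ⟨⟨⟨Submodule.span F (Set.range s), ?_⟩,
        ⟨fun i => ⟨s i, Submodule.subset_span ⟨i, rfl⟩⟩, ?_⟩⟩, ?_⟩
      · rw [finrank_span_eq_card hs, Fintype.card_fin]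
      · exact linearIndependent_span hs
      · rfl
  have h1 := Nat.card_congr (Equiv.ofBijective f hf)
  have hV := card_linearIndependent (K := F) (V := V) hk
  rw [hV, Nat.card_sigma] at h1
  have h2 : ∀ W : {W : Submodule F V // finrank F W = k},
      Nat.card {s : Fin k → W.1 // LinearIndependent F s} = alphaq (Fintype.card F) k k := by
    rintro ⟨W, hW⟩
    have := card_linearIndependent (K := F) (V := W) hW.ge
    simp only [this, hW, alphaq]
    exact Fin.prod_univ_eq_prod_range (fun i => Fintype.card F ^ k - Fintype.card F ^ i) k
  simp only [h2, Finset.sum_const, Finset.card_univ, smul_eq_mul] at h1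
  rw [Nat.card_eq_fintype_card, h1, alphaq]
  exact Fin.prod_univ_eq_prod_range
    (fun i => Fintype.card F ^ (finrank F V) - Fintype.card F ^ i) k

theorem card_subspaces_codim (F : Type*) [Field F] [Fintype F] (n r : ℕ) (hr : r ≤ n) :
    Nat.card {W : Submodule F (Fin n → F) // finrank F W = n - r} =
      gaussBinom (Fintype.card F) n r := by
  have hd : finrank F (Dual F (Fin n → F)) = n := by rw [Subspace.dual_finrank_eq]; simp
  have h := card_subspaces_mul F (V := Dual F (Fin n → F)) r (by rw [hd]; exact hr)
  rw [hd] at h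
  have hpos : 0 < alphaq (Fintype.card F) r r := by
    apply Finset.prod_pos
    intro i hi
    exact Nat.sub_pos_of_lt (Nat.pow_lt_pow_right Fintype.one_lt_card (Finset.mem_range.1 hi))
  rw [gaussBinom, ← h, Nat.mul_div_cancel _ hpos]
  have e : Submodule F (Fin n → F) ≃ Submodule F (Dual F (Fin n → F)) :=
    (Subspace.orderIsoFiniteDimensional (K := F) (V := Fin n → F)).toEquiv.trans OrderDual.ofDual
  refine Nat.card_congr (Equiv.subtypeEquiv
    ((Subspace.orderIsoFiniteDimensional (K := F) (V := Fin n → F)).toEquiv.trans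
      OrderDual.ofDual) ?_)
  intro W
  have h1 := Subspace.finrank_add_finrank_dualAnnihilator_eq W
  have h2 : finrank F (Fin n → F) = n := by simp
  change finrank F W = n - r ↔ finrank F (Submodule.dualAnnihilator W) = r
  omega

theorem rank_add_ker {F : Type*} [Field F] {m n : ℕ} (X : Matrix (Fin m) (Fin n) F) :
    X.rank + finrank F (LinearMap.ker X.mulVecLin) = n := by
  have := LinearMap.finrank_range_add_finrank_ker X.mulVecLin
  simpa [Matrix.rank] using this

theorem code_upper (F : Type*) [Field F] [Fintype F] (m n r : ℕ) (hr1 : 1 ≤ r) (hrn : r ≤ n)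
    (C : Set (Matrix (Fin m) (Fin n) F)) (h1 : ∀ X ∈ C, X.rank = r)
    (h2 : ∀ X ∈ C, ∀ Y ∈ C, X ≠ Y → r ≤ (X - Y).rank) :
    C.ncard ≤ gaussBinom (Fintype.card F) n r * (Fintype.card F ^ m - 1) := by
  classical
  have hex : ∀ K : {W : Submodule F (Fin n → F) // finrank F W = n - r},
      ∃ v : Fin n → F, v ∉ K.1 := by
    rintro ⟨K, hK⟩
    by_contra! h
    have : K = ⊤ := by ext x; simp [h x]
    subst this
    simp at hK
    omega
  choose v hv using hex
  have hker : ∀ X ∈ C, finrank F (LinearMap.ker X.mulVecLin) = n - r := by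
    intro X hX
    have := rank_add_ker X
    have := h1 X hX
    omega
  let f : C → {W : Submodule F (Fin n → F) // finrank F W = n - r} × {w : Fin m → F // w ≠ 0} :=
    fun X => (⟨LinearMap.ker X.1.mulVecLin, hker X.1 X.2⟩,
      ⟨X.1.mulVecLin (v ⟨LinearMap.ker X.1.mulVecLin, hker X.1 X.2⟩),
        fun h => hv ⟨LinearMap.ker X.1.mulVecLin, hker X.1 X.2⟩ (LinearMap.mem_ker.2 h)⟩)
  have hf : Function.Injective f := by
    rintro ⟨X, hX⟩ ⟨Y, hY⟩ hXY
    by_contra hne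
    have hne' : X ≠ Y := fun h => hne (Subtype.ext h)
    have hK : (⟨LinearMap.ker X.mulVecLin, hker X hX⟩ :
      {W : Submodule F (Fin n → F) // finrank F W = n - r}) =
      ⟨LinearMap.ker Y.mulVecLin, hker Y hY⟩ := congrArg Prod.fst hXY
    have hw : X.mulVecLin (v ⟨LinearMap.ker X.mulVecLin, hker X hX⟩) =
      Y.mulVecLin (v ⟨LinearMap.ker Y.mulVecLin, hker Y hY⟩) :=
        congrArg (fun z => z.2.1) hXY
    rw [← hK] at hw
    have hK' : LinearMap.ker X.mulVecLin = LinearMap.ker Y.mulVecLin := congrArg Subtype.val hK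
    have hle : LinearMap.ker X.mulVecLin ≤ LinearMap.ker (X - Y).mulVecLin := by
      intro x hx
      have hy := hx
      rw [hK'] at hy
      rw [LinearMap.mem_ker] at hx hy ⊢
      simp only [Matrix.mulVecLin_apply, Matrix.sub_mulVec] at hx hy ⊢
      rw [hx, hy, sub_zero]
    have hr := h2 X hX Y hY hne'
    have hs := rank_add_ker (X - Y)
    have heq := Submodule.eq_of_le_of_finrank_le hle (by rw [hker X hX]; omega)
    apply hv ⟨LinearMap.ker X.mulVecLin, hker X hX⟩
    refine heq.ge (LinearMap.mem_ker.2 ?_)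
    simp only [Matrix.mulVecLin_apply, Matrix.sub_mulVec] at hw ⊢
    rw [hw, sub_self]
  have : Finite (Submodule F (Fin n → F)) :=
    Finite.of_injective (fun W => (W : Set (Fin n → F))) SetLike.coe_injective
  have hc := Nat.card_le_card_of_injective f hf
  rw [Nat.card_prod, card_subspaces_codim F n r hrn] at hc
  have hz : Nat.card {w : Fin m → F // w ≠ 0} = Fintype.card F ^ m - 1 := by
    rw [Nat.card_eq_fintype_card, Fintype.card_subtype_compl, Fintype.card_subtype_eq]
    simp
  rw [hz] at hc
  exact hc

theorem linearized_ker (F E : Type*) [Field F] [Fintype F] [Field E] [Algebra F E]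
    [Module.Finite F E] (k : ℕ) (a : Fin (k + 1) → E) (ha : a ≠ 0) (K : Submodule F E)
    (hK : ∀ x ∈ K, ∑ i, a i * x ^ (Fintype.card F ^ (i : ℕ)) = 0) : finrank F K ≤ k := by
  classical
  have : Finite E := Module.finite_of_finite F
  have := Fintype.ofFinite K
  have hq : 1 < Fintype.card F := Fintype.one_lt_card
  let p : Polynomial E := ∑ i, Polynomial.C (a i) * Polynomial.X ^ (Fintype.card F ^ (i : ℕ))
  have hp : p ≠ 0 := by
    intro h
    apply ha
    funext j
    have := congrArg (fun s => Polynomial.coeff s (Fintype.card F ^ (j : ℕ))) h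
    simp only [p, Polynomial.finsetSum_coeff, Polynomial.coeff_C_mul_X_pow,
      Polynomial.coeff_zero] at this
    rw [Finset.sum_eq_single j] at this
    · simpa using this
    · intro b _ hb
      rw [if_neg]
      intro h
      exact hb (Fin.ext (Nat.pow_right_injective hq h.symm))
    · simp
  have hdeg : p.natDegree ≤ Fintype.card F ^ k := by
    apply Polynomial.natDegree_sum_le_of_forall_le
    intro i _
    refine (Polynomial.natDegree_C_mul_X_pow_le _ _).trans ?_
    exact Nat.pow_le_pow_right hq.le (by omega)
  have hsub : (Finset.univ.map ⟨fun x : K => (x : E), Subtype.val_injective⟩).val ⊆ p.roots := by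
    intro x hx
    simp only [Finset.mem_val, Finset.mem_map, Finset.mem_univ, true_and,
      Function.Embedding.coeFn_mk] at hx
    obtain ⟨y, rfl⟩ := hx
    rw [Polynomial.mem_roots hp, Polynomial.IsRoot.def]
    simpa [p, Polynomial.eval_finsetSum] using hK y y.2
  have h3 := Polynomial.card_le_degree_of_subset_roots hsub
  rw [Finset.card_map, Finset.card_univ, Module.card_eq_pow_finrank (K := F) (V := K)] at h3
  exact (Nat.pow_le_pow_iff_right hq).1 (h3.trans hdeg)

theorem code_lower_aux (F E : Type*) [Field F] [Fintype F] [Field E] [Algebra F E]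
    [Module.Finite F E] (m n r : ℕ) (hE : finrank F E = m) (hr1 : 1 ≤ r) (hrn : r ≤ n)
    (hnm : n ≤ m) :
    ∃ C : Set (Matrix (Fin m) (Fin n) F), (∀ X ∈ C, X.rank = r) ∧
    (∀ X ∈ C, ∀ Y ∈ C, X ≠ Y → r ≤ (X - Y).rank) ∧
    C.ncard = gaussBinom (Fintype.card F) n r * (Fintype.card F ^ m - 1) := by
  classical
  have : Finite E := Module.finite_of_finite F
  have hEc : Nat.card E = Nat.card F ^ m := by
    rw [Module.natCard_eq_pow_finrank (K := F), hE]
  obtain ⟨ι, hι⟩ := (finrank_le_iff_exists_linearMap (R := F) (M := Fin n → F) (M' := E)).1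
    (by rw [hE]; simpa using hnm)
  let eE : E ≃ₗ[F] (Fin m → F) := LinearEquiv.ofFinrankEq _ _ (by rw [hE]; simp)
  set k := n - r with hk
  let L : (Fin (k + 1) → E) → (Fin n → F) →ₗ[F] E := fun a =>
    ∑ i, a i • (((FiniteField.frobeniusAlgHom F E) ^ (i : ℕ)).toLinearMap ∘ₗ ι)
  have hL : ∀ a x, L a x = ∑ i, a i * (ι x) ^ (Fintype.card F ^ (i : ℕ)) := by
    intro a x
    simp [L, LinearMap.sum_apply, AlgHom.coe_pow, FiniteField.coe_frobeniusAlgHom, pow_iterate]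
  have hLsub : ∀ a b, L (a - b) = L a - L b := by
    intro a b
    refine LinearMap.ext fun x => ?_
    simp only [LinearMap.sub_apply, hL, Pi.sub_apply, sub_mul, Finset.sum_sub_distrib]
  have hLk : ∀ a, a ≠ 0 → finrank F (LinearMap.ker (L a)) ≤ k := by
    intro a ha
    have := linearized_ker F E k a ha ((LinearMap.ker (L a)).map ι) (by
      rintro _ ⟨x, hx, rfl⟩
      rw [← hL]
      exact hx)
    rwa [← (Submodule.equivMapOfInjective ι hι (LinearMap.ker (L a))).finrank_eq] at this
  have hex : ∀ K : {W : Submodule F (Fin n → F) // finrank F W = k},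
      ∃ a : Fin (k + 1) → E, a ≠ 0 ∧ K.1 ≤ LinearMap.ker (L a) := by
    rintro ⟨K, hK⟩
    let b : Basis (Fin k) F K := finBasisOfFinrankEq F K hK
    let g : (Fin (k + 1) → E) →ₗ[E] (Fin k → E) :=
      { toFun := fun a j => L a (b j)
        map_add' := by
          intro x y; funext j; simp [hL, add_mul, Finset.sum_add_distrib]
        map_smul' := by
          intro c x; funext j; simp [hL, mul_assoc, Finset.mul_sum] }
    have hg : LinearMap.ker g ≠ ⊥ := LinearMap.ker_ne_bot_of_finrank_lt (by simp)
    obtain ⟨a, hag, ha⟩ := Submodule.exists_mem_ne_zero_of_ne_bot hg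
    refine ⟨a, ha, ?_⟩
    have hz : (L a) ∘ₗ K.subtype = 0 := by
      apply b.ext
      intro j
      exact congrFun (LinearMap.mem_ker.1 hag) j
    intro x hx
    exact LinearMap.congr_fun hz ⟨x, hx⟩
  choose a ha haK using hex
  have hkk : ∀ K (e : E), e ≠ 0 → LinearMap.ker (L (e • a K)) = K.1 := by
    intro K e he
    symm
    apply Submodule.eq_of_le_of_finrank_le
    · intro x hx
      have := haK K hx
      rw [LinearMap.mem_ker] at this ⊢
      rw [hL] at this ⊢
      simp [mul_assoc, ← Finset.mul_sum, this]
    · rw [K.2]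
      exact hLk _ (smul_ne_zero he (ha K))
  let M : ((Fin n → F) →ₗ[F] E) → Matrix (Fin m) (Fin n) F := fun l =>
    LinearMap.toMatrix' (eE.toLinearMap ∘ₗ l)
  have hMker : ∀ l, LinearMap.ker (M l).mulVecLin = LinearMap.ker l := by
    intro l
    have : (M l).mulVecLin = eE.toLinearMap ∘ₗ l := by
      rw [← Matrix.toLin'_apply']
      simp [M]
    rw [this, LinearMap.ker_comp, LinearEquiv.ker, Submodule.comap_bot]
  have hMsub : ∀ l l', M (l - l') = M l - M l' := by
    intro l l'
    simp [M, LinearMap.comp_sub]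
  let f : {W : Submodule F (Fin n → F) // finrank F W = k} × {e : E // e ≠ 0} →
    Matrix (Fin m) (Fin n) F := fun x => M (L (x.2.1 • a x.1))
  have hf : Function.Injective f := by
    rintro ⟨K, e, he⟩ ⟨K', e', he'⟩ h
    have h1 := hMker (L (e • a K))
    have h2 := hMker (L (e' • a K'))
    rw [hkk K e he] at h1
    rw [hkk K' e' he'] at h2
    have h' : M (L (e • a K)) = M (L (e' • a K')) := h
    have hKK : K = K' := Subtype.ext (by rw [← h1, ← h2, h'])
    subst hKK
    congr 2
    by_contra hne
    have h3 := hMker (L ((e - e') • a K))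
    rw [hkk K _ (sub_ne_zero.2 hne), sub_smul, hLsub, hMsub, h', sub_self] at h3
    have h4 := K.2
    rw [← h3] at h4
    rw [Matrix.mulVecLin_zero, LinearMap.ker_zero, finrank_top, finrank_fin_fun] at h4
    omega
  refine ⟨Set.range f, ?_, ?_, ?_⟩
  · rintro _ ⟨⟨K, e, he⟩, rfl⟩
    have h1 := rank_add_ker (M (L (e • a K)))
    rw [hMker, hkk K e he, K.2] at h1
    change (M (L (e • a K))).rank = r
    omega
  · rintro _ ⟨x, rfl⟩ _ ⟨y, rfl⟩ hne
    have h1 := rank_add_ker (f x - f y)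
    have h2 : f x - f y = M (L (x.2.1 • a x.1 - y.2.1 • a y.1)) := by
      rw [hLsub, hMsub]
    have h3 : x.2.1 • a x.1 - y.2.1 • a y.1 ≠ 0 := by
      intro h
      apply hne
      simp only [f]
      rw [sub_eq_zero.1 h]
    have h4 := hLk _ h3
    rw [← hMker, ← h2] at h4
    omega
  · rw [← Set.image_univ, Set.ncard_image_of_injective _ hf, Set.ncard_univ, Nat.card_prod,
      card_subspaces_codim F n r hrn]
    congr 1
    have := Fintype.ofFinite E
    rw [Nat.card_eq_fintype_card, Fintype.card_subtype_compl, Fintype.card_subtype_eq,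
      ← Nat.card_eq_fintype_card, hEc, Nat.card_eq_fintype_card]

theorem code_lower (F : Type*) [Field F] [Fintype F] (m n r : ℕ) (hr1 : 1 ≤ r) (hrn : r ≤ n)
    (hnm : n ≤ m) :
    ∃ C : Set (Matrix (Fin m) (Fin n) F), (∀ X ∈ C, X.rank = r) ∧
    (∀ X ∈ C, ∀ Y ∈ C, X ≠ Y → r ≤ (X - Y).rank) ∧
    C.ncard = gaussBinom (Fintype.card F) n r * (Fintype.card F ^ m - 1) := by
  obtain ⟨p, hp⟩ := CharP.exists F
  have : Fact p.Prime := ⟨CharP.char_is_prime F p⟩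
  have : NeZero m := ⟨by omega⟩
  exact code_lower_aux F (FiniteField.Extension F p m) m n r
    (FiniteField.finrank_extension F p m) hr1 hrn hnm

theorem stmt17 {q m n r : ℕ} (F : Type*) [Field F] [Fintype F] (hF : Fintype.card F = q)
    (hr1 : 1 ≤ r) (hrn : r ≤ n) (hnm : n ≤ m) :
    A_R F m n r r = gaussBinom q n r * (q ^ m - 1) := by
  subst hF
  have hq : 1 < Fintype.card F := Fintype.one_lt_card
  obtain ⟨C, h1, h2, h3⟩ := code_lower F m n r hr1 hrn hnm
  have hpos : 0 < gaussBinom (Fintype.card F) n r * (Fintype.card F ^ m - 1) := by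
    apply Nat.mul_pos
    · rw [← card_subspaces_codim F n r hrn]
      have hmul := card_subspaces_mul F (V := Fin n → F) (n - r) (by simp)
      have hp : 0 < alphaq (Fintype.card F) (finrank F (Fin n → F)) (n - r) := by
        apply Finset.prod_pos
        intro i hi
        have := Finset.mem_range.1 hi
        exact Nat.sub_pos_of_lt (Nat.pow_lt_pow_right hq (by simp; omega))
      rw [← hmul] at hp
      exact Nat.pos_of_mul_pos_right hp
    · exact Nat.sub_pos_of_lt (Nat.one_lt_pow (by omega) hq)
  apply IsGreatest.csSup_eq
  constructor
  · refine ⟨C, ?_, h1, h2, h3⟩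
    rw [← Set.ncard_pos, h3]
    exact hpos
  · rintro _ ⟨D, -, hD1, hD2, rfl⟩
    exact code_upper F m n r hr1 hrn D hD1 hD2
end

section
/- Let q be a prime power and 1 ≤ r < d ≤ n ≤ m. Then A_R(q,m,n,d,r) · q^{n(d−r−1)} ≥ [n r]_q (equivalently, A_R(q,m,n,d,r) ≥ [n r]_q · q^{n(r−d+1)}). -/
open Module

/-- Number of `r`-dimensional subspaces is at least the Gaussian binomial. -/
lemma gaussBinom_le_card {F V : Type*} [Field F] [Fintype F] [AddCommGroup V] [Module F V]
    [Finite V] (r : ℕ) (hr : r ≤ finrank F V) :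
    gaussBinom (Fintype.card F) (finrank F V) r ≤
      Nat.card {W : Submodule F V // finrank F W = r} := by
  classical
  have : Fintype V := Fintype.ofFinite V
  have hfin : Finite (Submodule F V) := inferInstance
  have : Fintype {W : Submodule F V // finrank F W = r} := Fintype.ofFinite _
  have key : alphaq (Fintype.card F) (finrank F V) r ≤
      alphaq (Fintype.card F) r r * Nat.card {W : Submodule F V // finrank F W = r} := by
    have h1 := card_linearIndependent (K := F) (V := V) hr
    have h2 : ∀ W : {W : Submodule F V // finrank F W = r},
        Nat.card { s : Fin r → W.1 // LinearIndependent F s } = alphaq (Fintype.card F) r r := by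
      intro W
      rw [card_linearIndependent (K := F) (V := W.1) W.2.ge, W.2, alphaq, Finset.prod_range]
    rw [alphaq, Finset.prod_range, ← h1]
    have h3 : Nat.card (Σ W : {W : Submodule F V // finrank F W = r},
        { s : Fin r → W.1 // LinearIndependent F s }) =
        alphaq (Fintype.card F) r r * Nat.card {W : Submodule F V // finrank F W = r} := by
      rw [Nat.card_sigma]
      simp only [h2]
      rw [Finset.sum_const, Finset.card_univ, smul_eq_mul, mul_comm, Nat.card_eq_fintype_card]
    rw [← h3]
    refine Nat.card_le_card_of_injective (fun s => ⟨⟨Submodule.span F (Set.range s.1), ?_⟩,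
      ⟨fun i => ⟨s.1 i, Submodule.subset_span ⟨i, rfl⟩⟩, ?_⟩⟩) ?_
    · rw [finrank_span_eq_card s.2, Fintype.card_fin]
    · exact LinearIndependent.of_comp (Submodule.subtype _) s.2
    · intro s s' h
      have h4 := congrArg (fun p : (Σ W : {W : Submodule F V // finrank F W = r},
        { s : Fin r → W.1 // LinearIndependent F s }) =>
          (fun i => ((p.2.1 i : p.1.1) : V))) h
      exact Subtype.ext h4
  exact Nat.div_le_of_le_mul key

/-- A `q`-polynomial of `q`-degree `< k` vanishing on a `k`-dimensional space is zero. -/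
lemma qpoly_root {F L : Type*} [Field F] [Fintype F] [Field L] [Algebra F L] [Finite L]
    (k : ℕ) (c : ℕ → L) (U : Submodule F L) (hU : k ≤ finrank F U)
    (h : ∀ u ∈ U, ∑ i ∈ Finset.range k, c i * u ^ (Fintype.card F ^ i) = 0) :
    ∀ i < k, c i = 0 := by
  classical
  have : Fintype L := Fintype.ofFinite L
  have hq : 1 < Fintype.card F := Fintype.one_lt_card
  set q := Fintype.card F with hqdef
  let p : Polynomial L := ∑ i ∈ Finset.range k, Polynomial.C (c i) * Polynomial.X ^ (q ^ i)
  have hp : p = 0 := by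
    apply Polynomial.eq_zero_of_natDegree_lt_card_of_eval_eq_zero' p
      (Finset.univ.filter (fun x => x ∈ U))
    · intro i hi
      simp only [p, Polynomial.eval_finsetSum, Polynomial.eval_mul, Polynomial.eval_C,
        Polynomial.eval_pow, Polynomial.eval_X]
      exact h i (by simpa using hi)
    · have hcard : (Finset.univ.filter (fun x => x ∈ U)).card = q ^ finrank F U := by
        rw [← Fintype.card_subtype]
        exact Module.card_eq_pow_finrank (K := F) (V := U)
      rw [hcard]
      refine lt_of_lt_of_le ?_ (Nat.pow_le_pow_right (by omega) hU)
      have : p.natDegree ≤ q ^ k - 1 := by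
        refine Polynomial.natDegree_sum_le_of_forall_le _ _ (fun i hi => ?_)
        refine (Polynomial.natDegree_C_mul_X_pow_le _ _).trans ?_
        have := Nat.pow_lt_pow_right hq (Finset.mem_range.1 hi)
        omega
      have : 0 < q ^ k := by positivity
      omega
  intro i hi
  have h1 : p.coeff (q ^ i) = c i := by
    simp only [p, Polynomial.finsetSum_coeff, Polynomial.coeff_C_mul_X_pow]
    rw [Finset.sum_eq_single i]
    · simp
    · intro j _ hj
      rw [if_neg]
      intro h
      exact hj (Nat.pow_right_injective hq h).symm
    · intro h; exact absurd (Finset.mem_range.2 hi) h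
  rw [← h1, hp, Polynomial.coeff_zero]

/-- The `q`-polynomial map. -/
noncomputable def qpoly (F : Type*) {L : Type*} [Field F] [Fintype F] [Field L] [Algebra F L]
    (k : ℕ) (c : ℕ → L) : L →ₗ[F] L :=
  ∑ i ∈ Finset.range k, (LinearMap.mulLeft F (c i)).comp
    ((FiniteField.frobeniusAlgHom F L) ^ i).toLinearMap

lemma qpoly_apply {F L : Type*} [Field F] [Fintype F] [Field L] [Algebra F L]
    (k : ℕ) (c : ℕ → L) (x : L) :
    qpoly F k c x = ∑ i ∈ Finset.range k, c i * x ^ (Fintype.card F ^ i) := by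
  simp only [qpoly, LinearMap.sum_apply, LinearMap.comp_apply, LinearMap.mulLeft_apply,
    AlgHom.toLinearMap_apply, AlgHom.coe_pow, FiniteField.coe_frobeniusAlgHom, pow_iterate]

/-- Existence of a monic `q`-polynomial of `q`-degree `dim U` vanishing on `U`. -/
lemma exists_monic {F L : Type*} [Field F] [Fintype F] [Field L] [Algebra F L] [Finite L]
    (k : ℕ) (U : Submodule F L) (hU : finrank F U = k) :
    ∃ c : ℕ → L, c k = 1 ∧ ∀ u ∈ U, qpoly F (k + 1) c u = 0 := by
  classical
  have : Fintype L := Fintype.ofFinite L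
  let Φ : (Fin k → L) → (U →ₗ[F] L) := fun c =>
    (qpoly F k (fun i => if h : i < k then c ⟨i, h⟩ else 0)).comp U.subtype
  have hinj : Function.Injective Φ := by
    intro c c' hcc
    have := qpoly_root (F := F) k (fun i => if h : i < k then c ⟨i, h⟩ - c' ⟨i, h⟩ else 0) U hU.ge (by
      intro u hu
      have h1 := LinearMap.congr_fun hcc ⟨u, hu⟩
      simp only [Φ, LinearMap.comp_apply, Submodule.subtype_apply, qpoly_apply] at h1
      rw [← sub_eq_zero, ← Finset.sum_sub_distrib] at h1
      rw [← h1]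
      refine Finset.sum_congr rfl fun i hi => ?_
      rw [Finset.mem_range] at hi
      simp only [hi, dif_pos]
      ring)
    ext ⟨i, hi⟩
    have := this i hi
    simp only [hi, dif_pos] at this
    exact sub_eq_zero.1 this
  have hfinHom : Finite (U →ₗ[F] L) := Finite.of_injective _ DFunLike.coe_injective
  have hcard : Nat.card (Fin k → L) = Nat.card (U →ₗ[F] L) := by
    rw [Module.natCard_eq_pow_finrank (K := F) (V := (U →ₗ[F] L)), Module.finrank_linearMap, hU,
      Nat.card_fun, Module.natCard_eq_pow_finrank (K := F) (V := L), Nat.card_eq_fintype_card (α := Fin k), Fintype.card_fin,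
      ← pow_mul, mul_comm]
  have hbij : Function.Bijective Φ :=
    (Nat.bijective_iff_injective_and_card Φ).2 ⟨hinj, hcard⟩
  obtain ⟨c, hc⟩ := hbij.2
    (-(((FiniteField.frobeniusAlgHom F L) ^ k).toLinearMap.comp U.subtype))
  refine ⟨fun i => if h : i < k then c ⟨i, h⟩ else 1, by simp, fun u hu => ?_⟩
  have h1 := LinearMap.congr_fun hc ⟨u, hu⟩
  simp only [Φ, LinearMap.comp_apply, Submodule.subtype_apply, qpoly_apply, LinearMap.neg_apply,
    AlgHom.toLinearMap_apply, AlgHom.coe_pow, FiniteField.coe_frobeniusAlgHom, pow_iterate] at h1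
  rw [qpoly_apply, Finset.sum_range_succ]
  simp only [lt_irrefl, dif_neg, not_false_eq_true, one_mul]
  rw [eq_neg_iff_add_eq_zero] at h1
  rw [← h1]
  congr 1
  refine Finset.sum_congr rfl fun i hi => ?_
  rw [Finset.mem_range] at hi
  simp only [hi, dif_pos]

/-- Embedding of endomorphisms into `m × n` matrices, preserving rank. -/
lemma exists_matrix_embedding {F L : Type*} [Field F] [AddCommGroup L] [Module F L]
    [FiniteDimensional F L] (m n : ℕ) (hn : finrank F L = n) (hnm : n ≤ m) :
    ∃ T : (L →ₗ[F] L) →ₗ[F] Matrix (Fin m) (Fin n) F,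
      ∀ f, (T f).rank = finrank F (LinearMap.range f) := by
  obtain ⟨e⟩ : Nonempty ((Fin n → F) ≃ₗ[F] L) :=
    FiniteDimensional.nonempty_linearEquiv_of_finrank_eq (by simp [hn])
  obtain ⟨ι, hι⟩ : ∃ ι : L →ₗ[F] (Fin m → F), Function.Injective ι := by
    apply (finrank_le_iff_exists_linearMap).1
    simp [hn, hnm]
  refine ⟨(LinearMap.toMatrix' : ((Fin n → F) →ₗ[F] (Fin m → F)) ≃ₗ[F] _).toLinearMap ∘ₗ
    (LinearMap.lcomp F (Fin m → F) e.toLinearMap) ∘ₗ (LinearMap.llcomp F L L (Fin m → F) ι), fun f => ?_⟩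
  have : ((LinearMap.toMatrix' (ι ∘ₗ f ∘ₗ e.toLinearMap)) : Matrix (Fin m) (Fin n) F).rank
      = finrank F (LinearMap.range f) := by
    rw [Matrix.rank, ← Matrix.toLin'_apply', Matrix.toLin'_toMatrix', LinearMap.range_comp,
      LinearMap.range_comp_of_range_eq_top _ e.range]
    exact (LinearEquiv.finrank_eq (Submodule.equivMapOfInjective ι hι (LinearMap.range f))).symm
  exact this

theorem stmt18 {q m n d r : ℕ} (F : Type*) [Field F] [Fintype F] (hF : Fintype.card F = q)
    (hr1 : 1 ≤ r) (hrd : r < d) (hdn : d ≤ n) (hnm : n ≤ m) :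
    gaussBinom q n r ≤ A_R F m n d r * q ^ (n * (d - r - 1)) := by
  classical
  obtain ⟨p, hp⟩ := CharP.exists F
  have : Fact p.Prime := ⟨CharP.char_is_prime F p⟩
  have : NeZero n := ⟨by omega⟩
  let L := FiniteField.Extension F p n
  have hL : finrank F L = n := FiniteField.finrank_extension F p n
  have : Fintype L := Fintype.ofFinite L
  have hfinD : Finite (Dual F L) := Finite.of_injective _ DFunLike.coe_injective
  obtain ⟨T, hT⟩ := exists_matrix_embedding (F := F) (L := L) m n hL hnm
  have hD : finrank F (Dual F L) = n := by rw [Subspace.dual_finrank_eq, hL]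
  let S := {W : Submodule F (Dual F L) // finrank F W = r}
  have : Fintype S := Fintype.ofFinite _
  have hS : gaussBinom q n r ≤ Fintype.card S := by
    have := gaussBinom_le_card (F := F) (V := Dual F L) r (by omega)
    rwa [hD, hF, Nat.card_eq_fintype_card] at this
  refine hS.trans ?_
  let U : S → Submodule F L := fun W => W.1.dualCoannihilator
  have hU : ∀ W, finrank F (U W) = n - r := by
    intro W
    have := Subspace.finrank_add_finrank_dualCoannihilator_eq W.1
    rw [W.2, hL] at this
    change finrank F (W.1.dualCoannihilator) = _
    omega
  have hUinj : Function.Injective U := by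
    intro W W' h
    apply Subtype.ext
    rw [← Subspace.dualCoannihilator_dualAnnihilator_eq (W := W.1),
      ← Subspace.dualCoannihilator_dualAnnihilator_eq (W := W'.1)]
    exact congrArg Submodule.dualAnnihilator h
  choose c hc1 hc0 using fun W => exists_monic (n - r) (U W) (hU W)
  let f : S → (L →ₗ[F] L) := fun W => qpoly F (n - r + 1) (c W)
  have hker : ∀ W, LinearMap.ker (f W) = U W := by
    intro W
    symm
    apply Submodule.eq_of_le_of_finrank_le
    · intro u hu
      exact hc0 W u hu
    · rw [hU]
      by_contra hlt
      push Not at hlt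
      have := qpoly_root (F := F) (n - r + 1) (c W) (LinearMap.ker (f W)) hlt (by
        intro u hu
        rw [← qpoly_apply]
        exact hu) (n - r) (by omega)
      rw [hc1] at this
      exact one_ne_zero this
  have hrank : ∀ W, (T (f W)).rank = r := by
    intro W
    have := LinearMap.finrank_range_add_finrank_ker (f W)
    rw [hker, hU, hL] at this
    rw [hT]
    omega
  have hfinj : Function.Injective f := by
    intro W W' h
    apply hUinj
    rw [← hker, ← hker, h]
  let col : S → (Fin (d - r - 1) → L) := fun W i => c W (n - d + 1 + i)
  have hdist : ∀ W W', col W = col W' → W ≠ W' → d ≤ (T (f W) - T (f W')).rank := by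
    intro W W' hcol hne
    rw [← map_sub, hT]
    by_contra hlt
    push Not at hlt
    have hrn := LinearMap.finrank_range_add_finrank_ker (f W - f W')
    rw [hL] at hrn
    have hhigh : ∀ i, n - d + 1 ≤ i → i < n - r + 1 → c W i = c W' i := by
      intro i hi1 hi2
      rcases Nat.lt_or_ge i (n - r) with h | h
      · have := congrFun hcol ⟨i - (n - d + 1), by omega⟩
        simp only [col] at this
        rwa [Nat.add_sub_cancel' hi1] at this
      · have : i = n - r := by omega
        rw [this, hc1, hc1]
    have hval : ∀ u, (f W - f W') u =
        ∑ i ∈ Finset.range (n - d + 1), (c W i - c W' i) * u ^ (Fintype.card F ^ i) := by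
      intro u
      simp only [f, LinearMap.sub_apply, qpoly_apply]
      rw [← Finset.sum_sub_distrib]
      symm
      rw [← Finset.sum_subset (Finset.range_subset_range.2 (show n - d + 1 ≤ n - r + 1 by omega))]
      · refine Finset.sum_congr rfl fun i _ => by ring
      · intro i hi hi'
        rw [Finset.mem_range] at hi hi'
        rw [hhigh i (by omega) hi, sub_self]
    have hz := qpoly_root (F := F) (n - d + 1) (fun i => c W i - c W' i)
      (LinearMap.ker (f W - f W')) (by omega) (by
        intro u hu
        rw [← hval]
        exact hu)
    apply hne
    apply hfinj
    rw [← sub_eq_zero]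
    ext u
    rw [hval, LinearMap.zero_apply]
    refine Finset.sum_eq_zero fun i hi => ?_
    have := hz i (Finset.mem_range.1 hi)
    rw [this, zero_mul]
  have hTinj : ∀ W W', col W = col W' → T (f W) = T (f W') → W = W' := by
    intro W W' h1 h2
    by_contra hne
    have := hdist W W' h1 hne
    rw [h2, sub_self, Matrix.rank_zero] at this
    omega
  have hcardcol : Fintype.card (Fin (d - r - 1) → L) = q ^ (n * (d - r - 1)) := by
    rw [Fintype.card_fun, Module.card_eq_pow_finrank (K := F) (V := L), hL, hF, Fintype.card_fin,
      pow_mul]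
  rw [← hcardcol, ← Finset.card_univ, ← Finset.card_univ]
  refine Finset.card_le_mul_card_image_of_maps_to (f := col) (fun _ _ => Finset.mem_univ _) _ ?_
  intro b _
  rcases Finset.eq_empty_or_nonempty (Finset.univ.filter (fun W => col W = b)) with he | hne
  · rw [he]; simp
  unfold A_R maxRankCode
  apply le_csSup
  · refine ⟨Nat.card (Matrix (Fin m) (Fin n) F), ?_⟩
    rintro _ ⟨C, _, _, _, rfl⟩
    exact Set.ncard_le_card C
  · refine ⟨Set.image (fun W => T (f W)) (Finset.univ.filter (fun W => col W = b) : Finset S),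
      ?_, ?_, ?_, ?_⟩
    · exact Set.Nonempty.image _ hne
    · rintro _ ⟨W, _, rfl⟩
      exact hrank W
    · rintro _ ⟨W, hW, rfl⟩ _ ⟨W', hW', rfl⟩ hne'
      simp only [Finset.coe_filter, Finset.mem_univ, true_and, Set.mem_setOf_eq] at hW hW'
      exact hdist W W' (hW.trans hW'.symm) (fun h => hne' (by rw [h]))
    · rw [Set.ncard_image_of_injOn, Set.ncard_coe_finset]
      intro W hW W' hW' h
      simp only [Finset.coe_filter, Finset.mem_univ, true_and, Set.mem_setOf_eq] at hW hW'
      exact hTinj W W' (hW.trans hW'.symm) h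
end
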